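/- arXiv:1501.07200 — 2 statements merged into one kernel-verified Lean document; each statement's English description precedes it below -/
import Mathlib

section
/- Let $E$ be a finite-dimensional real inner product space, let $\Sigma \subset E$ be a finite set of nonzero vectors, and for $\alpha \in \Sigma$ let $s_\alpha$ denote the orthogonal reflection $s_\alpha(x) = x - \tfrac{2\langle \alpha, x\rangle}{\langle \alpha, \alpha\rangle}\,\alpha$ in the hyperplane $C_\alpha = \{x \in E \mid \langle \alpha, x\rangle = 0\}$. Let $W$ be the group of linear isometries of $E$ generated by $\{s_\alpha \mid \alpha \in \Sigma\}$, and assume that $W$ is finite and that every element of $W$ that is an orthogonal reflection in some hyperplane equals $s_\alpha$ for some $\alpha \in \Sigma$. If $w \in W$, $w \neq \mathrm{id}$, and $S \subseteq E$ is a set that $w$ fixes pointwise (i.e. $w(x) = x$ for all $x \in S$), then there exists $\alpha \in \Sigma$ such that $S \subseteq C_\alpha$. -/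
open scoped RealInnerProductSpace

namespace ReflAux

variable {E : Type*} [NormedAddCommGroup E] [InnerProductSpace ℝ E] [FiniteDimensional ℝ E]

noncomputable def r (β : E) : E ≃ₗᵢ[ℝ] E := (Submodule.span ℝ {β})ᗮ.reflection

lemma r_apply {β : E} (h : ‖β‖ = 1) (x : E) : r β x = x - (2 * ⟪β, x⟫) • β := by
  rw [r, Submodule.reflection_orthogonal_apply, Submodule.reflection_singleton_apply]
  simp [h, mul_smul, two_smul]

lemma r_conj {β : E} (h : ‖β‖ = 1) (u : E ≃ₗᵢ[ℝ] E) : u * r β = r (u β) * u := by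
  ext x
  have h' : ‖u β‖ = 1 := by simp [h]
  simp [r_apply h, r_apply h', LinearIsometryEquiv.inner_map_map]

lemma r_sq (β : E) : r β * r β = 1 := by
  ext x
  simp [r]

lemma r_self {β : E} (h : ‖β‖ = 1) : r β β = -β := by
  rw [r_apply h, real_inner_self_eq_norm_sq, h]
  module

lemma r_neg (β : E) : r (-β) = r β := by
  have : Submodule.span ℝ {-β} = Submodule.span ℝ {β} := by
    rw [← Set.neg_singleton, Submodule.span_neg]
  unfold r
  simp only [this]

lemma r_finrank {β : E} (h : ‖β‖ = 1) : Module.finrank ℝ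
          (LinearMap.eqLocus ((r β).toLinearEquiv.toLinearMap) (LinearMap.id (R := ℝ) (M := E)))
          + 1 = Module.finrank ℝ E := by
  have hβ : β ≠ 0 := by rintro rfl; simp at h
  have : LinearMap.eqLocus ((r β).toLinearEquiv.toLinearMap) (LinearMap.id (R := ℝ) (M := E))
      = (Submodule.span ℝ {β})ᗮ := by
    ext x
    rw [LinearMap.mem_eqLocus, Submodule.mem_orthogonal_singleton_iff_inner_right]
    change r β x = x ↔ _
    rw [r_apply h]
    simp [hβ]
  rw [this, ← (Submodule.span ℝ {β}).finrank_add_finrank_orthogonal, finrank_span_singleton hβ,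
    add_comm]

/-- positive roots -/
def Pos (W : Subgroup (E ≃ₗᵢ[ℝ] E)) (v β : E) : Prop := ‖β‖ = 1 ∧ r β ∈ W ∧ 0 < ⟪β, v⟫

/-- simple roots -/
def Simp (W : Subgroup (E ≃ₗᵢ[ℝ] E)) (v β : E) : Prop :=
  Pos W v β ∧ ∀ γ, Pos W v γ → γ ≠ β → 0 < ⟪r β γ, v⟫

variable {W : Subgroup (E ≃ₗᵢ[ℝ] E)} {v : E}

lemma mem_conj {β : E} (h : ‖β‖ = 1) (hb : r β ∈ W) {u : E ≃ₗᵢ[ℝ] E} (hu : u ∈ W) :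
    r (u β) ∈ W := by
  have : r (u β) = u * r β * u⁻¹ := by rw [r_conj h]; group
  rw [this]
  exact W.mul_mem (W.mul_mem hu hb) (W.inv_mem hu)

lemma prod_mem (L : List E) (hL : ∀ β ∈ L, Simp W v β) : (L.map r).prod ∈ W := by
  apply Subgroup.list_prod_mem
  intro x hx
  obtain ⟨β, hβ, rfl⟩ := List.mem_map.1 hx
  exact (hL β hβ).1.2.1

lemma exch (hreg : ∀ β : E, ‖β‖ = 1 → r β ∈ W → ⟪β, v⟫ ≠ 0) (α : E) (hα : Pos W v α)
    (L : List E) (hL : ∀ β ∈ L, Simp W v β)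
    (hneg : ⟪(L.map r).prod α, v⟫ < 0) :
    ∃ L' : List E, (∀ β ∈ L', Simp W v β) ∧ L'.length < L.length ∧
      (L.map r).prod * r α = (L'.map r).prod := by
  induction L with
  | nil =>
    exfalso
    have := hα.2.2
    simp at hneg
    linarith
  | cons σ M ih =>
    have hM : ∀ β ∈ M, Simp W v β := fun β hb => hL β (List.mem_cons_of_mem _ hb)
    have hσ := hL σ List.mem_cons_self
    have hMW := prod_mem M hM
    have hn : ‖(M.map r).prod α‖ = 1 := by simp [hα.1]
    have hr := mem_conj hα.1 hα.2.1 hMW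
    rcases lt_or_gt_of_ne (hreg _ hn hr) with h | h
    · obtain ⟨L', h1, h2, h3⟩ := ih hM h
      refine ⟨σ :: L', ?_, by simpa using h2, ?_⟩
      · intro β hb
        rcases List.mem_cons.1 hb with rfl | hb
        · exact hσ
        · exact h1 β hb
      · simp [mul_assoc, h3]
    · have heq : (M.map r).prod α = σ := by
        by_contra hc
        have := hσ.2 _ ⟨hn, hr, h⟩ hc
        rw [List.map_cons, List.prod_cons] at hneg
        exact lt_asymm this hneg
      refine ⟨M, hM, by simp, ?_⟩
      rw [List.map_cons, List.prod_cons, mul_assoc, r_conj hα.1, heq, ← mul_assoc, r_sq, one_mul]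

lemma free_list (hreg : ∀ β : E, ‖β‖ = 1 → r β ∈ W → ⟪β, v⟫ ≠ 0) (n : ℕ) :
    ∀ (L : List E), L.length = n → (∀ β ∈ L, Simp W v β) → (L.map r).prod v = v →
      (L.map r).prod = 1 := by
  induction n using Nat.strong_induction_on with
  | _ n ih =>
  intro L hn hL hv
  rcases List.eq_nil_or_concat' L with rfl | ⟨M, σ, rfl⟩
  · simp
  have hM : ∀ β ∈ M, Simp W v β := fun β hb => hL β (by simp [hb])
  have hσ : Simp W v σ := hL σ (by simp)
  have key : ⟪(M.map r).prod σ, v⟫ < 0 := by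
    have h1 : ⟪((M ++ [σ]).map r).prod σ, ((M ++ [σ]).map r).prod v⟫ = ⟪σ, v⟫ :=
      LinearIsometryEquiv.inner_map_map _ _ _
    rw [hv] at h1
    simp [r_self hσ.1.1] at h1
    have := hσ.1.2.2
    linarith
  obtain ⟨L', h1, h2, h3⟩ := exch hreg σ hσ.1 M hM key
  have h4 : ((M ++ [σ]).map r).prod = (L'.map r).prod := by simpa using h3
  rw [h4] at hv ⊢
  simp at hn
  exact ih L'.length (by omega) L' rfl h1 hv

lemma r_inj {β γ : E} (hb : Pos W v β) (hc : Pos W v γ) (h : r β = r γ) : β = γ := by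
  have h1 : r γ β = -β := by rw [← h, r_self hb.1]
  rw [r_apply hc.1] at h1
  have h2 : β = ⟪γ, β⟫ • γ := by
    have : (2:ℝ) • β = (2:ℝ) • (⟪γ, β⟫ • γ) := by
      rw [smul_smul, two_smul]
      nth_rewrite 1 [sub_eq_iff_eq_add.1 h1]
      abel
    exact smul_right_injective E (two_ne_zero : (2:ℝ) ≠ 0) this
  set c := ⟪γ, β⟫
  have h3 : |c| = 1 := by
    have := congrArg norm h2
    rw [norm_smul, hb.1, hc.1] at this
    simpa using this.symm
  have h4 : 0 < c * ⟪γ, v⟫ := by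
    have := hb.2.2
    rwa [h2, real_inner_smul_left] at this
  have h5 : 0 < c := (pos_iff_pos_of_mul_pos h4).2 hc.2.2
  rw [abs_of_pos h5] at h3
  rw [h2, h3, one_smul]

lemma pos_finite [Finite W] : {β : E | Pos W v β}.Finite := by
  apply Set.Finite.of_finite_image (f := r)
  · exact (Set.toFinite (W : Set (E ≃ₗᵢ[ℝ] E))).subset (by rintro _ ⟨β, hb, rfl⟩; exact hb.2.1)
  · intro β hb γ hc h
    exact r_inj hb hc h

lemma pos_step (hreg : ∀ β : E, ‖β‖ = 1 → r β ∈ W → ⟪β, v⟫ ≠ 0) {β γ : E} (hb : Pos W v β)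
    (hc : Pos W v γ) (hne : γ ≠ β) (hpos : 0 < ⟪γ, β⟫) (hlt : ⟪γ, v⟫ < ⟪β, v⟫) :
    ∃ δ, Pos W v δ ∧ ⟪δ, v⟫ < ⟪β, v⟫ ∧ r β = r γ * r δ * r γ := by
  have hlt1 : ⟪γ, β⟫ < 1 := by
    exact (inner_lt_one_iff_real_of_norm_eq_one hc.1 hb.1).2 hne
  have hn : ‖r γ β‖ = 1 := by simp [hb.1]
  have hr : r (r γ β) ∈ W := mem_conj hb.1 hb.2.1 hc.2.1
  have hval : ⟪r γ β, v⟫ = ⟪β, v⟫ - 2 * ⟪γ, β⟫ * ⟪γ, v⟫ := by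
    rw [r_apply hc.1, inner_sub_left, real_inner_smul_left]
  have hid : r β = r γ * r (r γ β) * r γ := by
    rw [mul_assoc, ← r_conj hb.1, ← mul_assoc, r_sq, one_mul]
  have hg := hc.2.2
  have hp : 0 < ⟪γ, β⟫ * ⟪γ, v⟫ := mul_pos hpos hg
  have hq : ⟪γ, β⟫ * ⟪γ, v⟫ < ⟪γ, v⟫ := by nlinarith
  rcases lt_or_gt_of_ne (hreg _ hn hr) with h | h
  · refine ⟨-(r γ β), ⟨by simpa using hn, by rwa [r_neg], by rw [inner_neg_left]; linarith⟩, ?_, ?_⟩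
    · rw [inner_neg_left, hval]; nlinarith
    · rwa [r_neg]
  · exact ⟨r γ β, ⟨hn, hr, h⟩, by rw [hval]; nlinarith, hid⟩

lemma pos_mem [Finite W] (hreg : ∀ β : E, ‖β‖ = 1 → r β ∈ W → ⟪β, v⟫ ≠ 0) (β : E)
    (hb : Pos W v β) : r β ∈ Submonoid.closure (r '' {β | Simp W v β}) := by
  by_contra hcon
  set T := Submonoid.closure (r '' {β | Simp W v β})
  have hf : {β : E | Pos W v β ∧ r β ∉ T}.Finite := pos_finite.subset (fun x hx => hx.1)
  obtain ⟨β, ⟨hb, hbT⟩, hmin⟩ := Set.exists_min_image _ (fun β => ⟪β, v⟫) hf ⟨β, hb, hcon⟩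
  have hT : ∀ γ, Pos W v γ → ⟪γ, v⟫ < ⟪β, v⟫ → r γ ∈ T := by
    intro γ hc hlt
    by_contra h
    have := hmin γ ⟨hc, h⟩
    linarith
  have fin : ∀ γ, Pos W v γ → γ ≠ β → 0 < ⟪γ, β⟫ → ⟪γ, v⟫ < ⟪β, v⟫ → False := by
    intro γ hc hne hpos hlt
    obtain ⟨δ, hd, hdl, he⟩ := pos_step hreg hb hc hne hpos hlt
    apply hbT
    rw [he]
    exact T.mul_mem (T.mul_mem (hT γ hc hlt) (hT δ hd hdl)) (hT γ hc hlt)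
  have hns : ¬ Simp W v β := fun h => hbT (Submonoid.subset_closure ⟨β, h, rfl⟩)
  have : ∃ γ, Pos W v γ ∧ γ ≠ β ∧ ⟪r β γ, v⟫ ≤ 0 := by
    by_contra! h
    exact hns ⟨hb, h⟩
  obtain ⟨γ, hc, hne, hle⟩ := this
  have hn : ‖r β γ‖ = 1 := by simp [hc.1]
  have hr : r (r β γ) ∈ W := mem_conj hc.1 hc.2.1 hb.2.1
  have hlt := lt_of_le_of_ne hle (hreg _ hn hr)
  have hval : ⟪r β γ, v⟫ = ⟪γ, v⟫ - 2 * ⟪β, γ⟫ * ⟪β, v⟫ := by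
    rw [r_apply hb.1, inner_sub_left, real_inner_smul_left]
  have hbv := hb.2.2
  have hcv := hc.2.2
  have hpos : 0 < ⟪γ, β⟫ := by
    rw [real_inner_comm]
    by_contra! h
    nlinarith
  have hlt1 : ⟪γ, β⟫ < 1 := (inner_lt_one_iff_real_of_norm_eq_one hc.1 hb.1).2 hne
  by_cases hh : ⟪γ, v⟫ < ⟪β, v⟫
  · exact fin γ hc hne hpos hh
  · have hi : ⟪-(r β γ), β⟫ = ⟪γ, β⟫ := by
      rw [r_apply hb.1, inner_neg_left, inner_sub_left, real_inner_smul_left,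
        real_inner_self_eq_norm_sq, hb.1, real_inner_comm γ β]
      ring
    refine fin (-(r β γ)) ⟨by simpa using hn, by rwa [r_neg], by rw [inner_neg_left]; linarith⟩
      ?_ (by rwa [hi]) ?_
    · intro h
      rw [h, real_inner_self_eq_norm_sq, hb.1] at hi
      linarith
    · rw [inner_neg_left, hval, real_inner_comm γ β]
      nlinarith

lemma free [Finite W] (hreg : ∀ β : E, ‖β‖ = 1 → r β ∈ W → ⟪β, v⟫ ≠ 0)
    {A : Set (E ≃ₗᵢ[ℝ] E)} (hA : ∀ g ∈ A, ∃ β, ‖β‖ = 1 ∧ g = r β) (hW : W = Subgroup.closure A)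
    {w : E ≃ₗᵢ[ℝ] E} (hw : w ∈ W) (hwv : w v = v) : w = 1 := by
  have hAW : A ⊆ W := by rw [hW]; exact Subgroup.subset_closure
  have hAT : A ⊆ Submonoid.closure (r '' {β | Simp W v β}) := by
    intro g hg
    obtain ⟨β, h1, rfl⟩ := hA g hg
    have hbW : r β ∈ W := hAW hg
    rcases lt_or_gt_of_ne (hreg _ h1 hbW) with h | h
    · rw [← r_neg]
      exact pos_mem hreg (-β) ⟨by simpa using h1, by rwa [r_neg], by rw [inner_neg_left]; linarith⟩
    · exact pos_mem hreg β ⟨h1, hbW, h⟩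
  have hinv : A⁻¹ ⊆ A := by
    intro g hg
    obtain ⟨β, h1, h2⟩ := hA _ hg
    have : g = g⁻¹ := by
      rw [h2, ← inv_inv g, h2, inv_eq_iff_mul_eq_one]
      exact r_sq β
    rw [this]; exact hg
  have hwT : w ∈ Submonoid.closure (r '' {β | Simp W v β}) := by
    rw [hW, ← Subgroup.mem_toSubmonoid, Subgroup.closure_toSubmonoid,
      Set.union_eq_self_of_subset_right hinv] at hw
    exact (Submonoid.closure_le.2 hAT) hw
  obtain ⟨l, hl, rfl⟩ := Submonoid.exists_list_of_mem_closure hwT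
  have : ∃ L : List E, (∀ β ∈ L, Simp W v β) ∧ l = L.map r := by
    clear hw hwv hwT
    induction l with
    | nil => exact ⟨[], by simp, rfl⟩
    | cons a l ih =>
      obtain ⟨L, h1, h2⟩ := ih (fun y hy => hl y (List.mem_cons_of_mem _ hy))
      obtain ⟨β, hb, rfl⟩ := hl a List.mem_cons_self
      refine ⟨β :: L, ?_, by simp [h2]⟩
      intro γ hc
      rcases List.mem_cons.1 hc with rfl | hc
      · exact hb
      · exact h1 γ hc
  obtain ⟨L, h1, rfl⟩ := this
  exact free_list hreg _ L rfl h1 hwv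

end ReflAux

/-- **Lemma.** Let `W` be the finite reflection group generated by the orthogonal reflections
`s_α`, `α ∈ Sg`, where `s_α x = x - (2⟪α,x⟫/⟪α,α⟫) • α`, and suppose every element of `W` that
is an orthogonal reflection in a hyperplane (a linear isometry squaring to the identity whose
fixed-point set has codimension one) is one of the `s_α`.  If `w ∈ W`, `w ≠ id`, fixes a set
`S` pointwise, then `S` is contained in the hyperplane `C_α = {x | ⟪α, x⟫ = 0}` for some
`α ∈ Sg`. -/
theorem exists_root_hyperplane_containing_fixed_set
    (E : Type*) [NormedAddCommGroup E] [InnerProductSpace ℝ E] [FiniteDimensional ℝ E]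
    (Sg : Finset E) (hne : ∀ α ∈ Sg, α ≠ 0)
    (W : Subgroup (E ≃ₗᵢ[ℝ] E))
    (hgen : W = Subgroup.closure
      {g : E ≃ₗᵢ[ℝ] E | ∃ α ∈ Sg, ∀ x, g x = x - (2 * ⟪α, x⟫ / ⟪α, α⟫) • α})
    (hfin : Finite W)
    (hrefl : ∀ g ∈ W,
      (g * g = 1 ∧
        Module.finrank ℝ
          (LinearMap.eqLocus (g.toLinearEquiv.toLinearMap) (LinearMap.id (R := ℝ) (M := E)))
          + 1 = Module.finrank ℝ E) →
      ∃ α ∈ Sg, ∀ x, g x = x - (2 * ⟪α, x⟫ / ⟪α, α⟫) • α)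
    (w : E ≃ₗᵢ[ℝ] E) (hw : w ∈ W) (hwne : w ≠ 1)
    (S : Set E) (hS : ∀ x ∈ S, w x = x) :
    ∃ α ∈ Sg, S ⊆ {x : E | ⟪α, x⟫ = 0} := by
  by_contra! hcon
  have hv : ∃ v : E, w v = v ∧ ∀ α ∈ Sg, ⟪α, v⟫ ≠ 0 := by
    set V := LinearMap.eqLocus (w.toLinearEquiv.toLinearMap) (LinearMap.id (R := ℝ) (M := E))
    have hSV : ∀ x ∈ S, x ∈ V := fun x hx => hS x hx
    have h := Subspace.biUnion_ne_univ_of_top_notMem (k := ℝ) (E := V)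
      (s := Sg.image (fun α => LinearMap.ker ((innerₛₗ ℝ α).comp V.subtype))) (by
        intro hm
        obtain ⟨α, hα, ht⟩ := Finset.mem_image.1 hm
        apply hcon α hα
        intro x hx
        have : (⟨x, hSV x hx⟩ : V) ∈ LinearMap.ker ((innerₛₗ ℝ α).comp V.subtype) := by
          rw [ht]; trivial
        simpa using this)
    obtain ⟨x, hx⟩ := (Set.ne_univ_iff_exists_notMem _).1 h
    refine ⟨x, x.2, fun α hα h0 => hx ?_⟩
    simp only [Set.mem_iUnion]
    exact ⟨_, Finset.mem_image_of_mem _ hα, by simpa using h0⟩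
  obtain ⟨v, hwv, hreg⟩ := hv
  refine hwne (ReflAux.free (v := v) ?_ ?_ hgen hw hwv)
  · intro β hb hbW h0
    obtain ⟨α, hα, h⟩ := hrefl _ hbW ⟨ReflAux.r_sq β, ReflAux.r_finrank hb⟩
    have h1 := h β
    rw [ReflAux.r_self hb] at h1
    have h2 : β = (⟪α, β⟫ / ⟪α, α⟫) • α := by
      have : (2:ℝ) • β = (2:ℝ) • ((⟪α, β⟫ / ⟪α, α⟫) • α) := by
        rw [smul_smul, two_smul, ← mul_div_assoc, ← sub_eq_zero, add_sub_assoc, ← h1]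
        abel
      exact smul_right_injective E (two_ne_zero : (2:ℝ) ≠ 0) this
    rw [h2, real_inner_smul_left] at h0
    rcases mul_eq_zero.1 h0 with h3 | h3
    · rw [h3, zero_smul] at h2
      rw [h2] at hb
      simp at hb
    · exact hreg α hα h3
  · rintro g ⟨α, hα, h⟩
    have hn : ‖α‖ ≠ 0 := norm_ne_zero_iff.2 (hne α hα)
    have h1 : ‖‖α‖⁻¹ • α‖ = 1 := by
      rw [norm_smul, norm_inv, norm_norm, inv_mul_cancel₀ hn]
    refine ⟨‖α‖⁻¹ • α, h1, ?_⟩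
    ext x
    rw [h x, ReflAux.r_apply h1, real_inner_smul_left, smul_smul, real_inner_self_eq_norm_sq]
    congr 2
    field_simp
end

section
/- Let $a = (3,1,0,2)$, $b = (2,0,0,1)$, $c = (0,0,1,0)$ in $\mathbb{R}^4$, and let $\mathfrak{u}_1 = \mathrm{Span}(a, b, c)$. Then for each vector $H$ in the list $(6,4,2,0)$, $(4,2,2,0)$, $(3,3,1,1)$, $(3,3,1,-1)$, $(4,2,0,0)$, $(2,1,1,0)$, $(1,1,1,1)$, $(1,1,1,-1)$, $(2,0,0,0)$, $(1,1,0,0)$, $(0,0,0,0)$, there exist a permutation $\sigma$ of $\{1,2,3,4\}$ and signs $\varepsilon_1, \varepsilon_2, \varepsilon_3, \varepsilon_4 \in \{-1, 1\}$ with $\varepsilon_1\varepsilon_2\varepsilon_3\varepsilon_4 = 1$ such that the vector $(\varepsilon_1 H_{\sigma(1)}, \varepsilon_2 H_{\sigma(2)}, \varepsilon_3 H_{\sigma(3)}, \varepsilon_4 H_{\sigma(4)})$ lies in $\mathfrak{u}_1$. -/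
lemma u1_aux (H : Fin 4 → ℝ) (σ : Equiv.Perm (Fin 4)) (i j k l : Fin 4) (e d : ℝ)
    (hi : σ 0 = i) (hj : σ 1 = j) (hk : σ 2 = k) (hl : σ 3 = l)
    (he : e = 1 ∨ e = -1) (hd : d = e)
    (h : H i + e * H j = 2 * H l) :
    ∃ (σ : Equiv.Perm (Fin 4)) (ε : Fin 4 → ℝ),
        (∀ i, ε i = 1 ∨ ε i = -1) ∧ (∏ i, ε i) = 1 ∧
        (fun i => ε i * H (σ i)) ∈
          Submodule.span ℝ
            ({![3, 1, 0, 2], ![2, 0, 0, 1], ![0, 0, 1, 0]} : Set (Fin 4 → ℝ)) := by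
  subst hd
  refine ⟨σ, ![1, d, d, 1], ?_, ?_, ?_⟩
  · intro i
    fin_cases i <;> simp [he]
  · rcases he with rfl | rfl <;> simp [Fin.prod_univ_four]
  · rw [Submodule.mem_span_triple]
    refine ⟨d * H j, H l - 2 * (d * H j), d * H k, ?_⟩
    funext m
    fin_cases m <;> simp [hi, hj, hk, hl] <;> linarith

/-- Every vector `H` in the list of semisimple elements of `sl(2,ℝ)`-triples of `so(4,4)`
can be moved, by a permutation of coordinates together with an even number of sign changes
(the Weyl group of type `D₄`), into the span `𝔲₁` of `a = (3,1,0,2)`, `b = (2,0,0,1)`,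
`c = (0,0,1,0)`. -/
theorem weyl_D4_orbit_meets_u1 :
    ∀ H ∈ [(![6, 4, 2, 0] : Fin 4 → ℝ), ![4, 2, 2, 0], ![3, 3, 1, 1], ![3, 3, 1, -1],
        ![4, 2, 0, 0], ![2, 1, 1, 0], ![1, 1, 1, 1], ![1, 1, 1, -1], ![2, 0, 0, 0],
        ![1, 1, 0, 0], ![0, 0, 0, 0]],
      ∃ (σ : Equiv.Perm (Fin 4)) (ε : Fin 4 → ℝ),
        (∀ i, ε i = 1 ∨ ε i = -1) ∧ (∏ i, ε i) = 1 ∧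
        (fun i => ε i * H (σ i)) ∈
          Submodule.span ℝ
            ({![3, 1, 0, 2], ![2, 0, 0, 1], ![0, 0, 1, 0]} : Set (Fin 4 → ℝ)) := by
  intro H hH
  simp only [List.mem_cons, List.not_mem_nil, or_false] at hH
  rcases hH with rfl | rfl | rfl | rfl | rfl | rfl | rfl | rfl | rfl | rfl | rfl
  · exact u1_aux _ (Equiv.swap 1 2 * Equiv.swap 2 3) 0 2 3 1 (1) (1) (by decide) (by decide) (by decide) (by decide)
      (by norm_num) rfl (by simp <;> norm_num)
  · exact u1_aux _ (Equiv.swap 1 3) 0 3 2 1 (1) (1) (by decide) (by decide) (by decide) (by decide)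
      (by norm_num) rfl (by simp <;> norm_num)
  · exact u1_aux _ (Equiv.swap 1 2) 0 2 1 3 (-1) (-1) (by decide) (by decide) (by decide) (by decide)
      (by norm_num) rfl (by simp <;> norm_num)
  · exact u1_aux _ (Equiv.swap 2 3 * Equiv.swap 1 2) 0 3 1 2 (1) (1) (by decide) (by decide) (by decide) (by decide)
      (by norm_num) rfl (by simp <;> norm_num)
  · exact u1_aux _ (Equiv.swap 1 3) 0 3 2 1 (1) (1) (by decide) (by decide) (by decide) (by decide)
      (by norm_num) rfl (by simp <;> norm_num)
  · exact u1_aux _ (Equiv.swap 1 3) 0 3 2 1 (1) (1) (by decide) (by decide) (by decide) (by decide)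
      (by norm_num) rfl (by simp <;> norm_num)
  · exact u1_aux _ 1 0 1 2 3 (1) (1) (by decide) (by decide) (by decide) (by decide)
      (by norm_num) rfl (by simp <;> norm_num)
  · exact u1_aux _ (Equiv.swap 2 3) 0 1 3 2 (1) (1) (by decide) (by decide) (by decide) (by decide)
      (by norm_num) rfl (by simp <;> norm_num)
  · exact u1_aux _ (Equiv.swap 0 2) 2 1 0 3 (1) (1) (by decide) (by decide) (by decide) (by decide)
      (by norm_num) rfl (by simp <;> norm_num)
  · exact u1_aux _ 1 0 1 2 3 (-1) (-1) (by decide) (by decide) (by decide) (by decide)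
      (by norm_num) rfl (by simp <;> norm_num)
  · exact u1_aux _ 1 0 1 2 3 (1) (1) (by decide) (by decide) (by decide) (by decide)
      (by norm_num) rfl (by simp <;> norm_num)
end
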